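/- For every φ ∈ L_BAPAL, the Church–Rosser-type formula ◇□φ → □◇φ is valid with respect to the L_BAPAL semantics, where ◇χ abbreviates ¬□¬χ. -/

import Mathlib

/-- Boolean (propositional) formulas over atoms `P`. -/
inductive PLForm (P : Type) : Type
  | atom : P → PLForm P
  | neg : PLForm P → PLForm P
  | and : PLForm P → PLForm P → PLForm P

/-- The language L_BAPAL over agents `A` and atoms `P`. -/
inductive Form (A P : Type) : Type
  | atom : P → Form A P
  | neg : Form A P → Form A P
  | and : Form A P → Form A P → Form A P
  | know : A → Form A P → Form A P
  | ann : Form A P → Form A P → Form A P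
  | box : Form A P → Form A P

def PLForm.toForm {A P : Type} : PLForm P → Form A P
  | .atom p => .atom p
  | .neg φ => .neg φ.toForm
  | .and φ ψ => .and φ.toForm ψ.toForm

structure Model (A P : Type) where
  S : Type
  rel : A → S → S → Prop
  val : P → S → Prop

/-- An epistemic model: each accessibility relation is an equivalence relation. -/
def Model.IsEpistemic {A P : Type} (M : Model A P) : Prop :=
  ∀ a : A, Equivalence (M.rel a)

/-- Restriction of a model to a subset of its states. -/
def Model.restrict {A P : Type} (M : Model A P) (X : Set M.S) : Model A P where
  S := X
  rel a s t := M.rel a s.val t.val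
  val p s := M.val p s.val

/-- Satisfaction of boolean formulas. -/
def SatPL {A P : Type} (M : Model A P) (s : M.S) : PLForm P → Prop
  | .atom p => M.val p s
  | .neg φ => ¬ SatPL M s φ
  | .and φ ψ => SatPL M s φ ∧ SatPL M s ψ

/-- BAPAL satisfaction. -/
def Sat {A P : Type} : (M : Model A P) → M.S → Form A P → Prop
  | M, s, .atom p => M.val p s
  | M, s, .neg φ => ¬ Sat M s φ
  | M, s, .and φ ψ => Sat M s φ ∧ Sat M s ψ
  | M, s, .know a φ => ∀ t : M.S, M.rel a s t → Sat M t φ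
  | M, s, .ann φ ψ => ∀ h : Sat M s φ, Sat (M.restrict {t | Sat M t φ}) ⟨s, h⟩ ψ
  | M, s, .box ψ => ∀ (φ₀ : PLForm P) (h : SatPL M s φ₀),
      Sat (M.restrict {t | SatPL M t φ₀}) ⟨s, h⟩ ψ

def Valid {A P : Type} (φ : Form A P) : Prop :=
  ∀ M : Model A P, M.IsEpistemic → ∀ s : M.S, Sat M s φ

def Form.imp {A P : Type} (φ ψ : Form A P) : Form A P := .neg (.and φ (.neg ψ))
def Form.iff {A P : Type} (φ ψ : Form A P) : Form A P := .and (φ.imp ψ) (ψ.imp φ)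
def Form.dia {A P : Type} (φ : Form A P) : Form A P := .neg (.box (.neg φ))
def Form.khat {A P : Type} (a : A) (φ : Form A P) : Form A P := .neg (.know a (.neg φ))
def Form.diaAnn {A P : Type} (φ ψ : Form A P) : Form A P := .neg (.ann φ (.neg ψ))

def Form.occurs {A P : Type} (q : P) : Form A P → Prop
  | .atom p => p = q
  | .neg φ => φ.occurs q
  | .and φ ψ => φ.occurs q ∨ ψ.occurs q
  | .know _ φ => φ.occurs q
  | .ann φ ψ => φ.occurs q ∨ ψ.occurs q
  | .box φ => φ.occurs q

def Form.mapAtoms {A P Q : Type} (f : P → Q) : Form A P → Form A Q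
  | .atom p => .atom (f p)
  | .neg φ => .neg (φ.mapAtoms f)
  | .and φ ψ => .and (φ.mapAtoms f) (ψ.mapAtoms f)
  | .know a φ => .know a (φ.mapAtoms f)
  | .ann φ ψ => .ann (φ.mapAtoms f) (ψ.mapAtoms f)
  | .box φ => .box (φ.mapAtoms f)

/-- An isomorphism of models: a bijection of states preserving accessibility and valuation. -/
structure Model.Iso {A P : Type} (M N : Model A P) where
  toEquiv : M.S ≃ N.S
  rel_iff : ∀ a s t, M.rel a s t ↔ N.rel a (toEquiv s) (toEquiv t)
  val_iff : ∀ p s, M.val p s ↔ N.val p (toEquiv s)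

/-- An isomorphism restricts to corresponding sets of states. -/
def Model.Iso.restrict {A P : Type} {M N : Model A P} (e : M.Iso N) (X : Set M.S) (Y : Set N.S)
    (h : ∀ s, s ∈ X ↔ e.toEquiv s ∈ Y) : (M.restrict X).Iso (N.restrict Y) where
  toEquiv := e.toEquiv.subtypeEquiv h
  rel_iff a s t := e.rel_iff a s.val t.val
  val_iff p s := e.val_iff p s.val

theorem Model.Iso.satPL_iff {A P : Type} {M N : Model A P} (e : M.Iso N) (s : M.S)
    (φ : PLForm P) : SatPL M s φ ↔ SatPL N (e.toEquiv s) φ := by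
  induction φ with
  | atom p => exact e.val_iff p s
  | neg φ ih => exact not_congr ih
  | and φ ψ ihφ ihψ => exact and_congr ihφ ihψ

theorem Model.Iso.sat_iff {A P : Type} {M N : Model A P} (e : M.Iso N) (s : M.S)
    (φ : Form A P) : Sat M s φ ↔ Sat N (e.toEquiv s) φ := by
  induction φ generalizing M N with
  | atom p => exact e.val_iff p s
  | neg φ ih => exact not_congr (ih e s)
  | and φ ψ ihφ ihψ => exact and_congr (ihφ e s) (ihψ e s)
  | know a φ ih =>
    exact e.toEquiv.forall_congr fun t => imp_congr (e.rel_iff a s t) (ih e t)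
  | ann φ ψ ihφ ihψ =>
    exact forall_prop_congr (fun h => ihψ (e.restrict {t | Sat M t φ} {t | Sat N t φ}
      (ihφ e)) ⟨s, h⟩) (ihφ e s)
  | box ψ ih =>
    exact forall_congr' fun φ₀ => forall_prop_congr (fun h =>
      ih (e.restrict {t | SatPL M t φ₀} {t | SatPL N t φ₀}
        fun t => e.satPL_iff t φ₀) ⟨s, h⟩) (e.satPL_iff s φ₀)

/-- The truth of boolean formulas is unaffected by restricting the model. -/
theorem satPL_restrict {A P : Type} (M : Model A P) (X : Set M.S) (s : X) (φ : PLForm P) :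
    SatPL (M.restrict X) s φ ↔ SatPL M s.val φ := by
  induction φ with
  | atom p => exact Iff.rfl
  | neg φ ih => exact not_congr ih
  | and φ ψ ihφ ihψ => exact and_congr ihφ ihψ

/-- Boolean announcements commute up to isomorphism. -/
def Model.restrictComm {A P : Type} (M : Model A P) (φ ψ : PLForm P) :
    ((M.restrict {t | SatPL M t φ}).restrict
        {t | SatPL (M.restrict {t | SatPL M t φ}) t ψ}).Iso
      ((M.restrict {t | SatPL M t ψ}).restrict
        {t | SatPL (M.restrict {t | SatPL M t ψ}) t φ}) where
  toEquiv :=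
    { toFun := fun t => ⟨⟨t.1.1, (satPL_restrict M _ t.1 ψ).1 t.2⟩,
        (satPL_restrict M _ _ φ).2 t.1.2⟩
      invFun := fun t => ⟨⟨t.1.1, (satPL_restrict M _ t.1 φ).1 t.2⟩,
        (satPL_restrict M _ _ ψ).2 t.1.2⟩
      left_inv := fun _ => rfl
      right_inv := fun _ => rfl }
  rel_iff _ _ _ := Iff.rfl
  val_iff _ _ := Iff.rfl

/-- the Church–Rosser-type formula `◇□φ → □◇φ` is valid, where `◇χ := ¬□¬χ`. -/
theorem church_rosser_valid {A : Type} [Countable A] (φ : Form A ℕ) :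
    Valid (Form.imp (Form.dia (.box φ)) (.box (Form.dia φ))) := by
  rintro M - s ⟨hdia, hbox⟩
  refine hdia fun φ₀ h₀ hφ => hbox fun φ₁ h₁ hnot => ?_
  have h := hφ φ₁ ((satPL_restrict M _ ⟨s, h₀⟩ φ₁).2 h₁)
  exact hnot φ₀ ((satPL_restrict M _ ⟨s, h₁⟩ φ₀).2 h₀)
    (((M.restrictComm φ₀ φ₁).sat_iff _ φ).1 h)
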